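/- Let A = diag(a₁,…,a_n) be a diagonal n×n real matrix with nonnegative entries, b ∈ ℝⁿ, c ∈ ℝ, and suppose the symmetric (n+1)×(n+1) matrix W = [[A, b],[bᵀ, c]] is positive semidefinite. Then for every integer k ≥ 1, 0 ≤ σ_k(W) ≤ σ_k(A) + c σ_{k−1}(A). -/

import Mathlib

open Matrix

/-- The `k`-th elementary symmetric function of the eigenvalues of a square matrix `W`,
read off from the characteristic polynomial, with `σ_0 = 1` and `σ_k = 0` for `k` larger
than the size. -/
noncomputable def sigmaE {m : Type*} [Fintype m] [DecidableEq m] (k : ℕ)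
    (W : Matrix m m ℝ) : ℝ :=
  if k ≤ Fintype.card m then (-1 : ℝ) ^ k * W.charpoly.coeff (Fintype.card m - k) else 0

open Polynomial in
/-- The coefficients of a monic real polynomial with nonnegative roots alternate in sign. -/
theorem coeff_prod_X_sub_C_alternating {ι : Type*} (s : Finset ι) (a : ι → ℝ)
    (ha : ∀ i, 0 ≤ a i) (m : ℕ) :
    0 ≤ (-1 : ℝ) ^ (s.card + m) * (∏ i ∈ s, (X - C (a i))).coeff m := by
  classical
  induction s using Finset.induction_on generalizing m with
  | empty =>
    rcases m with _ | m
    · simp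
    · simp [coeff_one]
  | insert i s hi ih =>
    rw [Finset.prod_insert hi, Finset.card_insert_of_notMem hi, sub_mul, coeff_sub, coeff_C_mul]
    have h := mul_nonneg (ha i) (ih m)
    rcases m with _ | m
    · rw [coeff_X_mul_zero]
      ring_nf at h ⊢
      exact h
    · rw [coeff_X_mul]
      have h' := ih m
      ring_nf at h h' ⊢
      linarith

/-- Determinant of a bordered diagonal matrix with invertible diagonal block. -/
theorem det_bordered_diagonal_of_ne_zero {ι K : Type*} [Fintype ι] [DecidableEq ι] [Field K]
    (d b : ι → K) (c : K) (hd : ∀ i, d i ≠ 0) :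
    (fromBlocks (diagonal d) (of fun i (_ : Unit) => b i) (of fun (_ : Unit) j => b j)
      (of fun (_ : Unit) (_ : Unit) => c)).det =
      c * ∏ i, d i - ∑ i, b i ^ 2 * ∏ j ∈ Finset.univ.erase i, d j := by
  let : Invertible (diagonal d) := by
    refine ⟨diagonal fun i => (d i)⁻¹, ?_, ?_⟩ <;>
      simp [diagonal_mul_diagonal, hd]
  have hinv : ⅟(diagonal d) = diagonal fun i => (d i)⁻¹ := rfl
  rw [det_fromBlocks₁₁, hinv, det_diagonal, det_unique (n := Unit), Matrix.sub_apply, mul_apply]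
  simp only [mul_diagonal, of_apply]
  rw [mul_sub, mul_comm, Finset.mul_sum]
  congr 1
  refine Finset.sum_congr rfl fun i _ => ?_
  rw [← Finset.mul_prod_erase _ _ (Finset.mem_univ i)]
  field_simp [hd i]

/-- Determinant of a bordered diagonal matrix with nonzero diagonal entries over a domain. -/
theorem det_bordered_diagonal {ι R : Type*} [Fintype ι] [DecidableEq ι] [CommRing R] [IsDomain R]
    (d b : ι → R) (c : R) (hd : ∀ i, d i ≠ 0) :
    (fromBlocks (diagonal d) (of fun i (_ : Unit) => b i) (of fun (_ : Unit) j => b j)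
      (of fun (_ : Unit) (_ : Unit) => c)).det =
      c * ∏ i, d i - ∑ i, b i ^ 2 * ∏ j ∈ Finset.univ.erase i, d j := by
  have hinj := IsFractionRing.injective R (FractionRing R)
  apply hinj
  rw [RingHom.map_det]
  simp only [map_sub, map_mul, map_sum, map_prod, map_pow]
  rw [← det_bordered_diagonal_of_ne_zero (fun i => algebraMap R (FractionRing R) (d i))
    (fun i => algebraMap R (FractionRing R) (b i)) (algebraMap R (FractionRing R) c)
    fun i => (map_ne_zero_iff _ hinj).2 (hd i)]
  congr 1
  rw [RingHom.mapMatrix_apply, fromBlocks_map, diagonal_map (map_zero _)]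
  rfl

open Polynomial in
/-- Characteristic polynomial of a bordered diagonal matrix. -/
theorem charpoly_bordered_diagonal {ι : Type*} [Fintype ι] [DecidableEq ι] (a b : ι → ℝ) (c : ℝ) :
    (fromBlocks (diagonal a) (of fun i (_ : Unit) => b i) (of fun (_ : Unit) j => b j)
      (of fun (_ : Unit) (_ : Unit) => c)).charpoly =
      (X - C c) * ∏ i, (X - C (a i)) -
        ∑ i, C (b i ^ 2) * ∏ j ∈ Finset.univ.erase i, (X - C (a j)) := by
  have h := det_bordered_diagonal (fun i => X - C (a i)) (fun i => -C (b i)) (X - C c)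
    fun i => X_sub_C_ne_zero (a i)
  simp only [neg_sq, ← C_pow] at h
  rw [← h, charpoly, charmatrix_fromBlocks, charmatrix_diagonal]
  congr 1

/-- The elementary symmetric functions of the eigenvalues of a positive semidefinite matrix
are nonnegative. -/
theorem sigmaE_nonneg_of_posSemidef {m : Type*} [Fintype m] [DecidableEq m] {W : Matrix m m ℝ}
    (hW : W.PosSemidef) (k : ℕ) : 0 ≤ sigmaE k W := by
  unfold sigmaE
  split_ifs with hk
  · rw [charpoly_coeff_eq_sum_minors W k hk, ← mul_assoc, ← mul_pow]
    simp only [mul_neg, mul_one, neg_neg, one_pow, one_mul]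
    exact Finset.sum_nonneg fun s _ => (hW.submatrix _).det_nonneg
  · exact le_rfl

open Polynomial in
/-- Bordering a nonnegative diagonal matrix raises the elementary symmetric functions at most as
much as in the block diagonal case. -/
theorem sigmaE_bordered_diagonal_le {n : ℕ} (a b : Fin n → ℝ) (c : ℝ) (ha : ∀ i, 0 ≤ a i)
    (k : ℕ) (hk : 1 ≤ k) :
    sigmaE k (fromBlocks (diagonal a) (of fun i (_ : Unit) => b i)
        (of fun (_ : Unit) j => b j) (of fun (_ : Unit) (_ : Unit) => c)) ≤
      sigmaE k (diagonal a) + c * sigmaE (k - 1) (diagonal a) := by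
  obtain ⟨k, rfl⟩ := Nat.exists_eq_add_of_le' hk
  have hcard : Fintype.card (Fin n ⊕ Unit) = n + 1 := by simp
  simp only [sigmaE, hcard, Fintype.card_fin, add_tsub_cancel_right, add_le_add_iff_right,
    charpoly_bordered_diagonal, charpoly_diagonal]
  by_cases hkn : k ≤ n
  swap
  · simp [hkn, show ¬ k + 1 ≤ n by omega]
  obtain ⟨l, rfl⟩ := Nat.exists_eq_add_of_le hkn
  have hsum : 0 ≤ (-1 : ℝ) ^ (k + 1) *
      (∑ i, C (b i ^ 2) * ∏ j ∈ Finset.univ.erase i, (X - C (a j))).coeff l := by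
    rw [finsetSum_coeff, Finset.mul_sum]
    refine Finset.sum_nonneg fun i _ => ?_
    have h := coeff_prod_X_sub_C_alternating (Finset.univ.erase i) a ha l
    have hpow : (-1 : ℝ) ^ ((Finset.univ.erase i).card + l) = (-1) ^ (k + 1) := by
      have hc := Finset.card_erase_add_one (Finset.mem_univ i)
      rw [Finset.card_univ, Fintype.card_fin] at hc
      rw [neg_one_pow_congr]
      simp only [Nat.even_iff]
      omega
    rw [hpow] at h
    rw [coeff_C_mul, mul_left_comm]
    exact mul_nonneg (sq_nonneg _) h
  rw [if_pos hkn, if_pos hkn, show k + l + 1 - (k + 1) = l by omega,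
    show k + l - k = l by omega, coeff_sub, sub_mul, coeff_sub, coeff_C_mul]
  rcases l with _ | l
  · rw [coeff_X_mul_zero, if_neg (by omega)]
    ring_nf at hsum ⊢
    linarith
  · rw [coeff_X_mul, if_pos (by omega), show k + (l + 1) - (k + 1) = l by omega]
    rw [pow_succ] at hsum ⊢
    linarith

/-- for a positive semidefinite bordered diagonal matrix
`W = [[A, b],[bᵀ, c]]` with `A = diag(a)` having nonnegative entries, one has
`0 ≤ σ_k(W) ≤ σ_k(A) + c σ_{k−1}(A)` for every `k ≥ 1`. -/
theorem stmt12 {n : ℕ} (a b : Fin n → ℝ) (c : ℝ) (ha : ∀ i, 0 ≤ a i) (k : ℕ) (hk : 1 ≤ k)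
    (hpsd : (Matrix.fromBlocks (Matrix.diagonal a) (Matrix.of fun i (_ : Unit) => b i)
      (Matrix.of fun (_ : Unit) j => b j)
      (Matrix.of fun (_ : Unit) (_ : Unit) => c)).PosSemidef) :
    0 ≤ sigmaE k (Matrix.fromBlocks (Matrix.diagonal a) (Matrix.of fun i (_ : Unit) => b i)
        (Matrix.of fun (_ : Unit) j => b j) (Matrix.of fun (_ : Unit) (_ : Unit) => c)) ∧
    sigmaE k (Matrix.fromBlocks (Matrix.diagonal a) (Matrix.of fun i (_ : Unit) => b i)
        (Matrix.of fun (_ : Unit) j => b j) (Matrix.of fun (_ : Unit) (_ : Unit) => c)) ≤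
      sigmaE k (Matrix.diagonal a) + c * sigmaE (k - 1) (Matrix.diagonal a) := by
  exact ⟨sigmaE_nonneg_of_posSemidef hpsd k, sigmaE_bordered_diagonal_le a b c ha k hk⟩
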